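/- arXiv:1307.6683 — 3 statements merged into one kernel-verified Lean document; each statement's English description precedes it below -/
import Mathlib

section
/- Let I ⊆ ℝ be an interval, let x : I → [0,∞) be continuous, let Ψ : ℝ → [0,∞) be continuous, let β > 0 be a constant, and let ω : [0,∞) → (0,∞) be continuous and non-decreasing. Fix u₀ ≥ 0 and define Φ(u) := ∫_{u₀}^{u} ds/ω(s). If for all t, t' ∈ I with t < t' one has x(t) − x(t') ≤ β ∫_t^{t'} Ψ(s) ω(x(s)) ds, then for all t, t' ∈ I with t < t' one has Φ(x(t)) − Φ(x(t')) ≤ β ∫_t^{t'} Ψ(s) ds. -/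
open Set Filter MeasureTheory

/-- Bihari's comparison for globally continuous data, with the inequality anchored at the right
endpoint. -/
theorem bihari_of_continuous {a b β u₀ : ℝ} {z Ψ ω : ℝ → ℝ} (hab : a ≤ b)
    (hz : Continuous z) (hΨ : Continuous Ψ) (hω : Continuous ω)
    (hΨnn : ∀ s, 0 ≤ Ψ s) (hωpos : ∀ s, 0 < ω s) (hωmono : Monotone ω) (hβ : 0 ≤ β)
    (h : ∀ t ∈ Icc a b, z t - z b ≤ β * ∫ s in t..b, Ψ s * ω (z s)) :
    (∫ s in u₀..(z a), 1 / ω s) - (∫ s in u₀..(z b), 1 / ω s) ≤ β * ∫ s in a..b, Ψ s := by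
  have hinv : Continuous fun s => 1 / ω s := continuous_const.div hω fun s => (hωpos s).ne'
  have hp : Continuous fun s => Ψ s * ω (z s) := hΨ.mul (hω.comp hz)
  set y : ℝ → ℝ := fun t => z b + β * ∫ s in t..b, Ψ s * ω (z s) with hy
  set Φ : ℝ → ℝ := fun u => ∫ s in u₀..u, 1 / ω s with hΦ
  have hzy : ∀ t ∈ Icc a b, z t ≤ y t := fun t ht => by
    have := h t ht
    simp only [hy]
    linarith
  have hy' : ∀ t, HasDerivAt y (β * -(Ψ t * ω (z t))) t := fun t =>
    ((intervalIntegral.integral_hasDerivAt_left (hp.intervalIntegrable _ _)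
      (hp.stronglyMeasurableAtFilter _ _) hp.continuousAt).const_mul β).const_add (z b)
  have hΦ' : ∀ u, HasDerivAt Φ (1 / ω u) u := fun u => hinv.integral_hasStrictDerivAt u₀ u
    |>.hasDerivAt
  have hg' : ∀ t, HasDerivAt (fun t => Φ (y t) - β * ∫ s in t..b, Ψ s)
      (1 / ω (y t) * (β * -(Ψ t * ω (z t))) - β * -(Ψ t)) t := fun t =>
    ((hΦ' (y t)).comp t (hy' t)).sub
      ((intervalIntegral.integral_hasDerivAt_left (hΨ.intervalIntegrable _ _)
        (hΨ.stronglyMeasurableAtFilter _ _) hΨ.continuousAt).const_mul β)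
  have hmono : MonotoneOn (fun t => Φ (y t) - β * ∫ s in t..b, Ψ s) (Icc a b) := by
    refine monotoneOn_of_hasDerivWithinAt_nonneg (convex_Icc a b)
      (fun t _ => (hg' t).continuousAt.continuousWithinAt)
      (fun t _ => (hg' t).hasDerivWithinAt) fun t ht => ?_
    have hle : ω (z t) / ω (y t) ≤ 1 :=
      (div_le_one (hωpos _)).2 (hωmono (hzy t (interior_subset ht)))
    have heq : 1 / ω (y t) * (β * -(Ψ t * ω (z t))) - β * -(Ψ t)
        = β * Ψ t * (1 - ω (z t) / ω (y t)) := by ring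
    rw [heq]
    exact mul_nonneg (mul_nonneg hβ (hΨnn t)) (sub_nonneg.2 hle)
  have hab' := hmono (left_mem_Icc.2 hab) (right_mem_Icc.2 hab) hab
  have hyb : y b = z b := by simp [hy]
  simp only [hyb, intervalIntegral.integral_same, mul_zero, sub_zero] at hab'
  have hΦmono : Monotone Φ := monotone_of_hasDerivAt_nonneg hΦ' fun u => by
    have := hωpos u
    simp only [Pi.zero_apply]
    positivity
  have := hΦmono (hzy a (left_mem_Icc.2 hab))
  linarith

/-- **LaSalle–Bihari generalization of Gronwall's inequality (minus version).**
If `x : I → [0,∞)` is continuous on the interval `I`, `Ψ ≥ 0` is continuous,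
`β > 0`, `ω : [0,∞) → (0,∞)` is continuous and non-decreasing, and
`x(t) - x(t') ≤ β ∫_t^{t'} Ψ(s) ω(x(s)) ds` for all `t < t'` in `I`, then with
`Φ(u) = ∫_{u₀}^u ds/ω(s)` one has `Φ(x(t)) - Φ(x(t')) ≤ β ∫_t^{t'} Ψ(s) ds`. -/
theorem lasalle_bihari_minus (I : Set ℝ) (hI : I.OrdConnected)
    (x Ψ ω : ℝ → ℝ) (β u₀ : ℝ)
    (hx : ContinuousOn x I) (hxnn : ∀ t ∈ I, 0 ≤ x t)
    (hΨ : Continuous Ψ) (hΨnn : ∀ s, 0 ≤ Ψ s)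
    (hβ : 0 < β)
    (hω : ContinuousOn ω (Ici 0)) (hωpos : ∀ s ∈ Ici (0:ℝ), 0 < ω s)
    (hωmono : MonotoneOn ω (Ici 0))
    (hu₀ : 0 ≤ u₀)
    (hmain : ∀ t ∈ I, ∀ t' ∈ I, t < t' →
      x t - x t' ≤ β * ∫ s in t..t', Ψ s * ω (x s)) :
    ∀ t ∈ I, ∀ t' ∈ I, t < t' →
      (∫ s in u₀..(x t), 1 / ω s) - (∫ s in u₀..(x t'), 1 / ω s)
        ≤ β * ∫ s in t..t', Ψ s := by
  intro a ha b hb hab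
  have hsub : Icc a b ⊆ I := hI.out ha hb
  have hclamp : ∀ s, max a (min s b) ∈ Icc a b := fun s =>
    ⟨le_max_left _ _, max_le hab.le (min_le_right _ _)⟩
  have hclamp_eq : ∀ s ∈ Icc a b, max a (min s b) = s := fun s hs => by
    rw [min_eq_left hs.2, max_eq_right hs.1]
  have hz : Continuous fun s => x (max a (min s b)) :=
    hx.comp_continuous (by fun_prop) fun s => hsub (hclamp s)
  have hω' : Continuous fun s => ω (max s 0) :=
    hω.comp_continuous (by fun_prop) fun s => le_max_right s 0
  have key := bihari_of_continuous (u₀ := u₀) hab.le hz hΨ hω' hΨnn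
    (fun s => hωpos _ (le_max_right s 0))
    (fun s s' hs => hωmono (le_max_right s 0) (le_max_right s' 0) (max_le_max_right 0 hs))
    hβ.le fun t ht => by
      have hint : (∫ s in t..b, Ψ s * ω (max (x (max a (min s b))) 0))
          = ∫ s in t..b, Ψ s * ω (x s) := by
        refine intervalIntegral.integral_congr fun s hs => ?_
        rw [uIcc_of_le ht.2] at hs
        have hs' : s ∈ Icc a b := ⟨ht.1.trans hs.1, hs.2⟩
        simp only [hclamp_eq s hs', max_eq_left (hxnn s (hsub hs'))]
      rw [hint, hclamp_eq t ht, hclamp_eq b (right_mem_Icc.2 hab.le)]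
      rcases ht.2.eq_or_lt with rfl | htb
      · simp
      · exact hmain t (hsub ht) b hb htb
  have hΦ : ∀ v, 0 ≤ v → (∫ s in u₀..v, 1 / ω (max s 0)) = ∫ s in u₀..v, 1 / ω s := by
    intro v hv
    refine intervalIntegral.integral_congr fun s hs => ?_
    have hs0 : 0 ≤ s := (le_inf hu₀ hv).trans hs.1
    simp only [max_eq_left hs0]
  simp only [hclamp_eq a (left_mem_Icc.2 hab.le), hclamp_eq b (right_mem_Icc.2 hab.le)] at key
  rwa [hΦ _ (hxnn a ha), hΦ _ (hxnn b hb)] at key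
end

section
/- Let f : ℝ × ℝⁿ × ℝⁿ → ℝⁿ be continuous. Define E(t,q,v) := 1 + ‖q‖² + ‖v‖². Suppose that for every r > 0 there exist a constant K(r) > 0, a continuous non-decreasing function g_r : [1,∞) → [1,∞) with ∫₁^∞ dx/(x g_r(x)) = +∞, and a continuous family of antisymmetric linear maps F_t : ℝⁿ → ℝⁿ (⟨F_t v, v⟩ = 0 for all v), such that ‖f(t,q,v) − F_t v‖ ≤ g_r(E(t,q,v)) · E(t,q,v) / (K(r) + ‖v‖) for every (t,q,v) ∈ [−r,r] × ℝⁿ × ℝⁿ. Then every maximal solution of the second-order equation q̈(t) = f(t, q(t), q̇(t)) is defined on all of ℝ. (A solution q : I → ℝⁿ is maximal if it admits no extension to a solution on a strictly larger interval.) -/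
open Set Filter MeasureTheory
open scoped RealInnerProductSpace

/-- A solution of the second order ODE `q̈ = f(t, q, q̇)` on a nonempty interval
`I ⊆ ℝ`, recorded together with its velocity `q'`. -/
def IsSolutionSO {n : ℕ}
    (f : ℝ → EuclideanSpace ℝ (Fin n) → EuclideanSpace ℝ (Fin n) → EuclideanSpace ℝ (Fin n))
    (I : Set ℝ) (q q' : ℝ → EuclideanSpace ℝ (Fin n)) : Prop :=
  I.Nonempty ∧ I.OrdConnected ∧ ∀ t ∈ I,
    HasDerivWithinAt q (q' t) I t ∧ HasDerivWithinAt q' (f t (q t) (q' t)) I t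

/-- A maximal solution: a solution admitting no extension to a solution on a
strictly larger interval. -/
def IsMaximalSolutionSO {n : ℕ}
    (f : ℝ → EuclideanSpace ℝ (Fin n) → EuclideanSpace ℝ (Fin n) → EuclideanSpace ℝ (Fin n))
    (I : Set ℝ) (q q' : ℝ → EuclideanSpace ℝ (Fin n)) : Prop :=
  IsSolutionSO f I q q' ∧
    ∀ J r r', IsSolutionSO f J r r' → I ⊆ J → Set.EqOn q r I → Set.EqOn q' r' I → J = I

section Peano

variable {V : Type*} [NormedAddCommGroup V] [NormedSpace ℝ V]

/-- Tonelli's iterates for the delayed integral equation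
`u t = x₀ + ∫ s in 0..(t - δ)⁺, F s (u s)`. -/
noncomputable def tonelliIterate (F : ℝ → V → V) (x₀ : V) (δ : ℝ) : ℕ → ℝ → V
  | 0 => fun _ => x₀
  | j + 1 => fun t => x₀ + ∫ s in (0 : ℝ)..max (t - δ) 0, F s (tonelliIterate F x₀ δ j s)

theorem tonelliIterate_continuous {F : ℝ → V → V} (hF : Continuous fun p : ℝ × V => F p.1 p.2)
    (x₀ : V) (δ : ℝ) (j : ℕ) : Continuous (tonelliIterate F x₀ δ j) := by
  induction j with
  | zero => exact continuous_const
  | succ j ih =>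
    have hc : Continuous fun s => F s (tonelliIterate F x₀ δ j s) :=
      hF.comp (continuous_id.prodMk ih)
    exact continuous_const.add
      ((intervalIntegral.continuous_primitive (fun a b => hc.intervalIntegrable a b) 0).comp
        ((continuous_id.sub continuous_const).max continuous_const))

theorem tonelliIterate_succ_eq (F : ℝ → V → V) (x₀ : V) {δ : ℝ} (hδ : 0 ≤ δ) (j : ℕ) {t : ℝ}
    (ht : t ≤ j * δ) : tonelliIterate F x₀ δ (j + 1) t = tonelliIterate F x₀ δ j t := by
  induction j generalizing t with
  | zero =>
    have : max (t - δ) 0 = 0 := max_eq_right (by simp at ht; linarith)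
    simp [tonelliIterate, this]
  | succ j ih =>
    refine congrArg (x₀ + ·) ?_
    refine intervalIntegral.integral_congr fun s hs => ?_
    rw [uIcc_of_le (le_max_right _ _)] at hs
    have hj : (0 : ℝ) ≤ j * δ := by positivity
    have : s ≤ j * δ := hs.2.trans (max_le (by push_cast at ht; linarith) hj)
    simp only [ih this]

/-- Solutions of the delayed integral equation exist on `[0, 1]`. -/
theorem exists_delayed_solution {F : ℝ → V → V} (hF : Continuous fun p : ℝ × V => F p.1 p.2)
    (x₀ : V) {δ : ℝ} (hδ : 0 < δ) :
    ∃ u : ℝ → V, Continuous u ∧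
      ∀ t ≤ 1, u t = x₀ + ∫ s in (0 : ℝ)..max (t - δ) 0, F s (u s) := by
  obtain ⟨j, hj⟩ := exists_nat_ge (1 / δ)
  refine ⟨tonelliIterate F x₀ δ j, tonelliIterate_continuous hF x₀ δ j, fun t ht => ?_⟩
  rw [← tonelliIterate_succ_eq F x₀ hδ.le j (ht.trans ((div_le_iff₀ hδ).1 hj))]
  rfl

/-- **Peano's theorem**, global form for bounded vector fields. -/
theorem exists_integral_solution_of_bounded [FiniteDimensional ℝ V] {F : ℝ → V → V}
    (hF : Continuous fun p : ℝ × V => F p.1 p.2) {C : ℝ} (hC : ∀ t x, ‖F t x‖ ≤ C) (x₀ : V) :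
    ∃ y : ℝ → V, Continuous y ∧
      ∀ t ∈ Icc (0 : ℝ) 1, y t = x₀ + ∫ s in (0 : ℝ)..t, F s (y s) := by
  have : ProperSpace V := FiniteDimensional.proper_real V
  have hC0 : 0 ≤ C := (norm_nonneg _).trans (hC 0 0)
  choose u hu hueq using fun k : ℕ =>
    exists_delayed_solution hF x₀ (one_div_pos.2 (Nat.cast_add_one_pos k : (0 : ℝ) < k + 1))
  have hFu : ∀ k, Continuous fun s => F s (u k s) := fun k =>
    hF.comp (continuous_id.prodMk (hu k))
  have hint : ∀ k a b, IntervalIntegrable (fun s => F s (u k s)) volume a b := fun k a b =>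
    (hFu k).intervalIntegrable a b
  have hlip : ∀ k, ∀ t ≤ 1, ∀ s ≤ 1, dist (u k t) (u k s) ≤ C * dist t s := by
    intro k t ht s hs
    rw [hueq k t ht, hueq k s hs, dist_add_left, dist_eq_norm,
      intervalIntegral.integral_interval_sub_left (hint _ _ _) (hint _ _ _)]
    refine (intervalIntegral.norm_integral_le_of_norm_le_const fun _ _ => hC _ _).trans ?_
    refine mul_le_mul_of_nonneg_left ?_ hC0
    refine (abs_max_sub_max_le_abs _ _ _).trans ?_
    rw [sub_sub_sub_cancel_right, Real.dist_eq]
  have hu0 : ∀ k, u k 0 = x₀ := fun k => by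
    have : max ((0 : ℝ) - 1 / ((k : ℝ) + 1)) 0 = 0 :=
      max_eq_right (by rw [zero_sub]; exact neg_nonpos.2 (by positivity))
    rw [hueq k 0 zero_le_one, this]
    simp
  let w : ℕ → BoundedContinuousFunction (Icc (0 : ℝ) 1) V := fun k =>
    BoundedContinuousFunction.mkOfCompact ⟨fun t => u k t, (hu k).comp continuous_subtype_val⟩
  have hcomp : IsCompact (closure (range w)) := by
    refine BoundedContinuousFunction.arzela_ascoli (Metric.closedBall x₀ C)
      (isCompact_closedBall _ _) _ ?_ ?_
    · rintro _ t ⟨k, rfl⟩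
      have h := hlip k t t.2.2 0 zero_le_one
      rw [hu0] at h
      refine h.trans (mul_le_of_le_one_right hC0 ?_)
      rw [Real.dist_eq, sub_zero, abs_of_nonneg t.2.1]
      exact t.2.2
    · refine (LipschitzWith.uniformEquicontinuous _ C.toNNReal ?_).equicontinuous
      rintro ⟨_, k, rfl⟩
      refine LipschitzWith.of_dist_le_mul fun t s => ?_
      rw [Real.coe_toNNReal _ hC0]
      exact hlip k t t.2.2 s s.2.2
  obtain ⟨y, -, φ, hφ, hlim⟩ := hcomp.tendsto_subseq
    (fun k => subset_closure (mem_range_self k) : ∀ k, w k ∈ closure (range w))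
  have hpt : ∀ t : Icc (0 : ℝ) 1, Tendsto (fun k => u (φ k) t) atTop (nhds (y t)) := fun t =>
    ((BoundedContinuousFunction.lipschitz_eval_const t).continuous.tendsto y).comp hlim
  have hy : Continuous (IccExtend (zero_le_one' ℝ) y) := y.continuous.Icc_extend'
  refine ⟨IccExtend (zero_le_one' ℝ) y, hy, fun t ht => ?_⟩
  have h1 : Tendsto (fun k => x₀ + ∫ s in (0 : ℝ)..t, F s (u (φ k) s)) atTop
      (nhds (x₀ + ∫ s in (0 : ℝ)..t, F s (IccExtend (zero_le_one' ℝ) y s))) := by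
    refine tendsto_const_nhds.add ?_
    refine intervalIntegral.tendsto_integral_filter_of_dominated_convergence (fun _ => C)
      (.of_forall fun k => (hFu _).aestronglyMeasurable)
      (.of_forall fun k => .of_forall fun s _ => hC _ _) intervalIntegrable_const
      (.of_forall fun s hs => ?_)
    rw [uIoc_of_le ht.1] at hs
    have hs' : s ∈ Icc (0 : ℝ) 1 := ⟨hs.1.le, hs.2.trans ht.2⟩
    rw [IccExtend_of_mem _ _ hs']
    exact (hF.tendsto (s, y ⟨s, hs'⟩)).comp (tendsto_const_nhds.prodMk_nhds (hpt ⟨s, hs'⟩))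
  have h2 : Tendsto (fun k => (x₀ + ∫ s in (0 : ℝ)..t, F s (u (φ k) s)) - u (φ k) t) atTop
      (nhds 0) := by
    refine squeeze_zero_norm (a := fun k => C * (1 / ((φ k : ℝ) + 1))) (fun k => ?_) ?_
    · rw [hueq _ t ht.2, add_sub_add_left_eq_sub,
        intervalIntegral.integral_interval_sub_left (hint _ _ _) (hint _ _ _)]
      refine (intervalIntegral.norm_integral_le_of_norm_le_const fun _ _ => hC _ _).trans ?_
      refine mul_le_mul_of_nonneg_left ?_ hC0
      have hpos : 0 < 1 / ((φ k : ℝ) + 1) := by positivity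
      have hmax : max (t - 1 / ((φ k : ℝ) + 1)) 0 ≤ t := max_le (by linarith) ht.1
      rw [abs_of_nonneg (sub_nonneg.2 hmax)]
      linarith [le_max_left (t - 1 / ((φ k : ℝ) + 1)) 0]
    · have := (tendsto_one_div_add_atTop_nhds_zero_nat (𝕜 := ℝ)).comp hφ.tendsto_atTop
      simpa using this.const_mul C
  have h3 := h1.sub h2
  rw [sub_zero] at h3
  simp only [sub_sub_cancel] at h3
  rw [IccExtend_of_mem _ _ ht]
  exact tendsto_nhds_unique (hpt ⟨t, ht⟩) h3

/-- **Peano's theorem**: a continuous vector field has local forward solutions. -/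
theorem exists_forward_solution [FiniteDimensional ℝ V] {F : ℝ → V → V}
    (hF : Continuous fun p : ℝ × V => F p.1 p.2) (t₀ : ℝ) (x₀ : V) :
    ∃ b > t₀, ∃ z : ℝ → V, z t₀ = x₀ ∧
      ∀ t ∈ Icc t₀ b, HasDerivWithinAt z (F t (z t)) (Icc t₀ b) t := by
  have : ProperSpace V := FiniteDimensional.proper_real V
  have : CompleteSpace V := FiniteDimensional.complete ℝ V
  let τ : ℝ → ℝ := fun s => t₀ + max 0 (min s 1)
  let ρ : V → V := fun x => x₀ + (max 1 ‖x - x₀‖)⁻¹ • (x - x₀)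
  have hτ : Continuous τ := by fun_prop
  have hρ : Continuous ρ := by
    have h1 : Continuous fun x : V => (max 1 ‖x - x₀‖)⁻¹ :=
      Continuous.inv₀ (by fun_prop) fun x => (zero_lt_one.trans_le (le_max_left _ _)).ne'
    fun_prop
  have hG : Continuous fun p : ℝ × V => F (τ p.1) (ρ p.2) :=
    hF.comp ((hτ.comp continuous_fst).prodMk (hρ.comp continuous_snd))
  obtain ⟨C, hC⟩ := ((isCompact_Icc (a := t₀) (b := t₀ + 1)).prod
    (isCompact_closedBall x₀ 1)).exists_bound_of_continuousOn hF.continuousOn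
  have hbd : ∀ s x, ‖F (τ s) (ρ x)‖ ≤ C := by
    intro s x
    refine hC (τ s, ρ x) ⟨⟨?_, ?_⟩, ?_⟩
    · exact le_add_of_nonneg_right (le_max_left _ _)
    · exact add_le_add_right (max_le zero_le_one (min_le_right _ _)) _
    · have hpos : 0 < max 1 ‖x - x₀‖ := zero_lt_one.trans_le (le_max_left _ _)
      rw [mem_closedBall_iff_norm, add_sub_cancel_left, norm_smul, norm_inv,
        Real.norm_of_nonneg hpos.le, inv_mul_le_iff₀ hpos, mul_one]
      exact le_max_right _ _
  obtain ⟨y, hy, hyeq⟩ := exists_integral_solution_of_bounded hG hbd x₀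
  have hy0 : y 0 = x₀ := by simpa using hyeq 0 ⟨le_rfl, zero_le_one⟩
  obtain ⟨ε, hε, hball⟩ := Metric.continuous_iff.1 hy 0 1 one_pos
  have hder : ∀ s, HasDerivAt (fun t => x₀ + ∫ s in (0 : ℝ)..t, F (τ s) (ρ (y s)))
      (F (τ s) (ρ (y s))) s := fun s =>
    ((hG.comp (continuous_id.prodMk hy)).integral_hasStrictDerivAt 0 s).hasDerivAt.const_add _
  refine ⟨t₀ + min 1 (ε / 2), lt_add_of_pos_right _ (by positivity), fun t => y (t - t₀),
    by simpa using hy0, fun t ht => ?_⟩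
  have hmem : ∀ t ∈ Icc t₀ (t₀ + min 1 (ε / 2)), t - t₀ ∈ Icc (0 : ℝ) 1 := fun t ht =>
    ⟨by linarith [ht.1], by linarith [ht.2, min_le_left 1 (ε / 2)]⟩
  have hτt : τ (t - t₀) = t := by
    simp only [τ]
    rw [min_eq_left (hmem t ht).2, max_eq_right (hmem t ht).1]
    ring
  have hρt : ρ (y (t - t₀)) = y (t - t₀) := by
    have h := hball (t - t₀) (by
      rw [Real.dist_eq, sub_zero, abs_of_nonneg (hmem t ht).1]
      linarith [ht.2, min_le_right 1 (ε / 2)])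
    rw [hy0, dist_eq_norm] at h
    simp only [ρ]
    rw [max_eq_left h.le]
    simp
  have h := (hder (t - t₀)).comp_sub_const t t₀
  rw [hτt, hρt] at h
  exact h.hasDerivWithinAt.congr (fun s hs => hyeq _ (hmem s hs)) (hyeq _ (hmem t ht))

end Peano

section Extension

variable {V : Type*} [NormedAddCommGroup V] [NormedSpace ℝ V] [FiniteDimensional ℝ V]
  {F : ℝ → V → V} {I : Set ℝ} {b : ℝ} {x : ℝ → V}

/-- A solution whose interval contains its right endpoint extends strictly to the right. -/
theorem exists_extension_of_isGreatest (hF : Continuous fun p : ℝ × V => F p.1 p.2)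
    (hI : I.OrdConnected) (hx : ∀ t ∈ I, HasDerivWithinAt x (F t (x t)) I t)
    (hb : IsGreatest I b) :
    ∃ J y, J.OrdConnected ∧ (∀ t ∈ J, HasDerivWithinAt y (F t (y t)) J t) ∧ I ⊆ J ∧
      EqOn x y I ∧ ∃ c ∈ J, c ∉ I := by
  obtain ⟨c, hbc, z, hz0, hz⟩ := exists_forward_solution hF b (x b)
  let y : ℝ → V := fun t => if t ≤ b then x t else z t
  have hyx : EqOn y x I := fun t ht => if_pos (hb.2 ht)
  have hyz : EqOn y z (Icc b c) := by
    intro t ht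
    rcases ht.1.eq_or_lt with rfl | h
    · simp [y, hz0]
    · exact if_neg h.not_ge
  have hIcl : ∀ t, b < t → t ∉ closure I := fun t ht h =>
    ht.not_ge (closure_minimal (fun s hs => hb.2 hs) isClosed_Iic h)
  refine ⟨I ∪ Icc b c, y, ?_, ?_, subset_union_left, hyx.symm, c,
    .inr ⟨hbc.le, le_rfl⟩, fun h => hbc.not_ge (hb.2 h)⟩
  · refine ⟨?_⟩
    rintro s hs t ht u ⟨hsu, hut⟩
    have htc : t ≤ c := ht.elim (fun h => (hb.2 h).trans hbc.le) (·.2)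
    rcases le_total u b with hub | hbu
    · refine .inl ?_
      rcases hs with hs | hs
      · exact hI.out hs hb.1 ⟨hsu, hub⟩
      · rw [le_antisymm hub (hs.1.trans hsu)]
        exact hb.1
    · exact .inr ⟨hbu, hut.trans htc⟩
  · intro t ht
    have h1 : HasDerivWithinAt y (F t (y t)) I t := by
      by_cases htI : t ∈ I
      · rw [hyx htI]
        exact (hx t htI).congr_of_mem hyx htI
      · refine HasFDerivWithinAt.of_notMem_closure (hIcl t ?_)
        have := ht.resolve_left htI
        exact this.1.lt_of_ne fun h => htI (h ▸ hb.1)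
    have h2 : HasDerivWithinAt y (F t (y t)) (Icc b c) t := by
      by_cases htJ : t ∈ Icc b c
      · rw [hyz htJ]
        exact (hz t htJ).congr_of_mem hyz htJ
      · exact HasFDerivWithinAt.of_notMem_closure (by rwa [isClosed_Icc.closure_eq])
    exact h1.union h2

/-- A solution which stays bounded near an excluded right endpoint extends to that endpoint. -/
theorem exists_extension_of_bounded (hF : Continuous fun p : ℝ × V => F p.1 p.2)
    (hI : I.OrdConnected) (hx : ∀ t ∈ I, HasDerivWithinAt x (F t (x t)) I t)
    (hb : IsLUB I b) (hbI : b ∉ I) {a M : ℝ} (ha : a ∈ I) (hM : ∀ t ∈ Ico a b, ‖x t‖ ≤ M) :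
    ∃ J y, J.OrdConnected ∧ (∀ t ∈ J, HasDerivWithinAt y (F t (y t)) J t) ∧ I ⊆ J ∧
      EqOn x y I ∧ ∃ c ∈ J, c ∉ I := by
  have : ProperSpace V := FiniteDimensional.proper_real V
  have hlt : ∀ t ∈ I, t < b := fun t ht => (hb.1 ht).lt_of_ne fun h => hbI (h ▸ ht)
  have hIco : ∀ s ∈ I, Ico s b ⊆ I := fun s hs t ht => by
    obtain ⟨u, hu, htu⟩ := (lt_isLUB_iff hb).1 ht.2
    exact hI.out hs hu ⟨ht.1, htu.le⟩
  have hab : a < b := hlt a ha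
  obtain ⟨C, hC⟩ := ((isCompact_Icc (a := a) (b := b)).prod
    (isCompact_closedBall (0 : V) M)).exists_bound_of_continuousOn hF.continuousOn
  have hlip : LipschitzOnWith C.toNNReal x (Ico a b) := by
    refine (convex_Ico a b).lipschitzOnWith_of_nnnorm_hasDerivWithin_le
      (fun t ht => (hx t (hIco a ha ht)).mono (hIco a ha)) fun t ht => ?_
    exact NNReal.le_toNNReal_of_coe_le
      (hC (t, x t) ⟨⟨ht.1, ht.2.le⟩, mem_closedBall_zero_iff.2 (hM t ht)⟩)
  obtain ⟨z, hz, hxz⟩ := hlip.extend_finite_dimension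
  let y : ℝ → V := Function.update x b (z b)
  have hyb : y b = z b := Function.update_self ..
  have hyx : EqOn y x I := fun t ht => Function.update_of_ne (hlt t ht).ne _ _
  have hyz : EqOn y z (Ioo a b) := fun t ht =>
    (hyx (hIco a ha (Ioo_subset_Ico_self ht))).trans (hxz (Ioo_subset_Ico_self ht))
  have hI' : insert b I ⊆ Iic b := insert_subset self_mem_Iic fun t ht => (hlt t ht).le
  have hd : ∀ t ∈ Ioo a b, HasDerivAt y (F t (z t)) t := fun t ht => by
    have htI : I ∈ nhds t :=
      mem_of_superset (Ioo_mem_nhds ht.1 ht.2) (Ioo_subset_Ico_self.trans (hIco a ha))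
    have h := (hx t (mem_of_mem_nhds htI)).hasDerivAt htI
    rw [hxz (Ioo_subset_Ico_self ht)] at h
    exact h.congr_of_eventuallyEq (hyx.eventuallyEq_of_mem htI)
  refine ⟨insert b I, y, ?_, ?_, subset_insert _ _, hyx.symm, b, mem_insert _ _, hbI⟩
  · refine ⟨?_⟩
    rintro s hs t ht u ⟨hsu, hut⟩
    rcases (hut.trans (hI' ht)).eq_or_lt with rfl | hub
    · exact mem_insert _ _
    · rcases hs with rfl | hs
      · exact absurd hub hsu.not_gt
      · exact .inr (hIco s hs ⟨hsu, hub⟩)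
  · rintro t (rfl | ht)
    · rw [hyb]
      refine (hasDerivWithinAt_Iic_of_tendsto_deriv (s := Ioo a t)
        (fun s hs => (hd s hs).differentiableAt.differentiableWithinAt) ?_
        (Ioo_mem_nhdsLT hab) ?_).mono hI'
      · exact hz.continuous.continuousWithinAt.congr hyz hyb
      · have hlim : Tendsto (fun s => F s (z s)) (nhdsWithin t (Iio t)) (nhds (F t (z t))) :=
          ((hF.comp (continuous_id.prodMk hz.continuous)).tendsto t).mono_left nhdsWithin_le_nhds
        refine hlim.congr' ?_
        filter_upwards [Ioo_mem_nhdsLT hab] with s hs using (hd s hs).deriv.symm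
    · rw [hyx ht]
      exact HasFDerivWithinAt.insert' ((hx t ht).congr_of_mem hyx ht)

end Extension

/-- Osgood-type estimate: a function with `e' ≤ c e g(e)`, where `∫ dx / (x g x)` diverges,
stays bounded on bounded intervals. -/
theorem exists_bound_of_deriv_le_gauge {g : ℝ → ℝ} (hg : ContinuousOn g (Ici 1))
    (hg1 : ∀ x ∈ Ici (1 : ℝ), 1 ≤ g x)
    (hdiv : Tendsto (fun y => ∫ x in (1 : ℝ)..y, 1 / (x * g x)) atTop atTop)
    {e e' : ℝ → ℝ} {a b c : ℝ}
    (he : ∀ t ∈ Ico a b, HasDerivWithinAt e (e' t) (Ico a b) t) (he1 : ∀ t ∈ Ico a b, 1 ≤ e t)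
    (hc : 0 ≤ c) (hle : ∀ t ∈ Ico a b, e' t ≤ c * (e t * g (e t))) :
    ∃ M, ∀ t ∈ Ico a b, e t ≤ M := by
  let h : ℝ → ℝ := fun x => 1 / (max 1 x * g (max 1 x))
  have hmax : Continuous fun x : ℝ => max 1 x := by fun_prop
  have hpos : ∀ x ∈ Ici (1 : ℝ), 0 < x * g x := fun x hx =>
    mul_pos (zero_lt_one.trans_le hx) (zero_lt_one.trans_le (hg1 x hx))
  have hh : Continuous h := by
    refine continuous_const.div
      (hmax.mul (hg.comp_continuous hmax fun x => mem_Ici.2 (le_max_left _ _))) ?_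
    exact fun x => (hpos _ (mem_Ici.2 (le_max_left _ _))).ne'
  let G : ℝ → ℝ := fun y => ∫ x in (1 : ℝ)..y, h x
  have hG : ∀ y, HasDerivAt G (h y) y := fun y =>
    (hh.integral_hasStrictDerivAt 1 y).hasDerivAt
  have hGtop : Tendsto G atTop atTop := by
    refine hdiv.congr' ?_
    filter_upwards [eventually_ge_atTop 1] with y hy
    refine intervalIntegral.integral_congr fun x hx => ?_
    rw [uIcc_of_le hy] at hx
    simp only [h, max_eq_right hx.1]
  have hφ : ∀ t ∈ Ico a b,
      HasDerivWithinAt (fun t => G (e t) - c * t) (h (e t) * e' t - c * 1) (Ico a b) t :=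
    fun t ht => ((hG (e t)).comp_hasDerivWithinAt t (he t ht)).sub
      ((hasDerivWithinAt_id t _).const_mul c)
  have hanti : AntitoneOn (fun t => G (e t) - c * t) (Ico a b) := by
    refine antitoneOn_of_hasDerivWithinAt_nonpos (convex_Ico a b)
      (fun t ht => (hφ t ht).continuousWithinAt)
      (fun t ht => (hφ t (interior_subset ht)).mono interior_subset) fun t ht => ?_
    have ht := interior_subset ht
    have hp := hpos _ (he1 t ht)
    have : h (e t) = 1 / (e t * g (e t)) := by simp only [h, max_eq_right (he1 t ht)]
    rw [this, mul_one, sub_nonpos, one_div, inv_mul_le_iff₀ hp, mul_comm _ c]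
    exact hle t ht
  obtain ⟨M, hM⟩ := (tendsto_atTop_atTop.1 hGtop) (G (e a) - c * a + c * b + 1)
  refine ⟨M, fun t ht => le_of_not_gt fun hlt => ?_⟩
  have h1 := hM _ hlt.le
  have h2 := hanti ⟨le_rfl, ht.1.trans_lt ht.2⟩ ht ht.1
  simp only at h2
  nlinarith [mul_le_mul_of_nonneg_left ht.2.le hc]

/-- A maximal solution of a second order equation satisfying a gauge bound is not bounded
above in time. -/
theorem IsMaximalSolutionSO.not_bddAbove {n : ℕ}
    {f : ℝ → EuclideanSpace ℝ (Fin n) → EuclideanSpace ℝ (Fin n) → EuclideanSpace ℝ (Fin n)}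
    (hf : Continuous fun p : ℝ × EuclideanSpace ℝ (Fin n) × EuclideanSpace ℝ (Fin n) =>
      f p.1 p.2.1 p.2.2)
    (hbound : ∀ r > (0 : ℝ), ∃ K > (0 : ℝ), ∃ g : ℝ → ℝ,
      ContinuousOn g (Ici 1) ∧ (∀ x ∈ Ici (1 : ℝ), 1 ≤ g x) ∧
      Tendsto (fun y => ∫ x in (1 : ℝ)..y, 1 / (x * g x)) atTop atTop ∧
      ∃ F : ℝ → EuclideanSpace ℝ (Fin n) →L[ℝ] EuclideanSpace ℝ (Fin n),
        (∀ (t : ℝ) (v : EuclideanSpace ℝ (Fin n)), ⟪F t v, v⟫ = 0) ∧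
        ∀ t ∈ Icc (-r) r, ∀ x v : EuclideanSpace ℝ (Fin n),
          ‖f t x v - F t v‖ ≤
            g (1 + ‖x‖ ^ 2 + ‖v‖ ^ 2) * (1 + ‖x‖ ^ 2 + ‖v‖ ^ 2) / (K + ‖v‖))
    {I : Set ℝ} {q q' : ℝ → EuclideanSpace ℝ (Fin n)} (hq : IsMaximalSolutionSO f I q q') :
    ¬ BddAbove I := by
  intro hI
  obtain ⟨⟨⟨a, ha⟩, hconn, hsol⟩, hmax⟩ := hq
  let E := EuclideanSpace ℝ (Fin n)
  let Φ : ℝ → E × E → E × E := fun t p => (p.2, f t p.1 p.2)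
  have hΦ : Continuous fun p : ℝ × E × E => Φ p.1 p.2 := continuous_snd.snd.prodMk hf
  have hx : ∀ t ∈ I, HasDerivWithinAt (fun t => (q t, q' t)) (Φ t (q t, q' t)) I t :=
    fun t ht => (hsol t ht).1.prodMk (hsol t ht).2
  suffices ∃ (J : Set ℝ) (y : ℝ → E × E), J.OrdConnected ∧
      (∀ t ∈ J, HasDerivWithinAt y (Φ t (y t)) J t) ∧ I ⊆ J ∧
      EqOn (fun t => (q t, q' t)) y I ∧ ∃ c ∈ J, c ∉ I by
    obtain ⟨J, y, hJ, hy, hIJ, hxy, c, hcJ, hcI⟩ := this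
    refine hcI (hmax J (fun t => (y t).1) (fun t => (y t).2)
      ⟨⟨a, hIJ ha⟩, hJ, fun t ht => ⟨?_, ?_⟩⟩ hIJ
      (fun t ht => congrArg Prod.fst (hxy ht)) (fun t ht => congrArg Prod.snd (hxy ht)) ▸ hcJ)
    · exact hasFDerivAt_fst.comp_hasDerivWithinAt t (hy t ht)
    · exact hasFDerivAt_snd.comp_hasDerivWithinAt t (hy t ht)
  have hlub : IsLUB I (sSup I) := isLUB_csSup ⟨a, ha⟩ hI
  by_cases hbI : sSup I ∈ I
  · exact exists_extension_of_isGreatest hΦ hconn hx ⟨hbI, hlub.1⟩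
  set b := sSup I
  have hIco : Ico a b ⊆ I := fun t ht => by
    obtain ⟨u, hu, htu⟩ := (lt_isLUB_iff hlub).1 ht.2
    exact hconn.out ha hu ⟨ht.1, htu.le⟩
  obtain ⟨K, hK, g, hgc, hg1, hdiv, F, hF, hfF⟩ := hbound (|a| + |b| + 1) (by positivity)
  obtain ⟨M, hM⟩ := exists_bound_of_deriv_le_gauge hgc hg1 hdiv (a := a) (b := b) (c := 3)
    (e := fun t => 1 + ‖q t‖ ^ 2 + ‖q' t‖ ^ 2)
    (e' := fun t => 2 * ⟪q t, q' t⟫ + 2 * ⟪q' t, f t (q t) (q' t)⟫)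
    (fun t ht => (((hsol t (hIco ht)).1.norm_sq.const_add 1).add
      (hsol t (hIco ht)).2.norm_sq).mono hIco)
    (fun t _ => by nlinarith [sq_nonneg ‖q t‖, sq_nonneg ‖q' t‖]) (by norm_num) (by
      intro t ht
      have hr : t ∈ Icc (-(|a| + |b| + 1)) (|a| + |b| + 1) :=
        ⟨by linarith [ht.1, neg_abs_le a, abs_nonneg b],
          by linarith [ht.2, le_abs_self b, abs_nonneg a]⟩
      have hfb := hfF t hr (q t) (q' t)
      have hinner : ⟪q' t, f t (q t) (q' t)⟫ ≤ ‖q' t‖ * ‖f t (q t) (q' t) - F t (q' t)‖ := by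
        have := real_inner_le_norm (q' t) (f t (q t) (q' t) - F t (q' t))
        rwa [inner_sub_right, real_inner_comm (F t (q' t)), hF, sub_zero] at this
      have hqv := real_inner_le_norm (q t) (q' t)
      set e := 1 + ‖q t‖ ^ 2 + ‖q' t‖ ^ 2 with he
      have he1 : 1 ≤ e := by nlinarith [sq_nonneg ‖q t‖, sq_nonneg ‖q' t‖]
      have hge : e ≤ e * g e := le_mul_of_one_le_right (by linarith) (hg1 e he1)
      have hv : ‖q' t‖ * ‖f t (q t) (q' t) - F t (q' t)‖ ≤ e * g e := by
        have hv0 := norm_nonneg (q' t)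
        calc _ ≤ ‖q' t‖ * (g e * e / (K + ‖q' t‖)) := mul_le_mul_of_nonneg_left hfb hv0
          _ = (e * g e) * (‖q' t‖ / (K + ‖q' t‖)) := by ring
          _ ≤ e * g e := mul_le_of_le_one_right (by linarith)
              ((div_le_one (by linarith)).2 (by linarith))
      nlinarith [sq_nonneg (‖q t‖ - ‖q' t‖)])
  refine exists_extension_of_bounded hΦ hconn hx hlub hbI ha (M := M) fun t ht => ?_
  have := hM t ht
  refine norm_prod_le_iff.2 ⟨?_, ?_⟩
  · nlinarith [sq_nonneg (‖q t‖ - 1), sq_nonneg ‖q' t‖, norm_nonneg (q t)]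
  · nlinarith [sq_nonneg (‖q' t‖ - 1), sq_nonneg ‖q t‖, norm_nonneg (q' t)]

/-- Time reversal of solutions. -/
theorem IsSolutionSO.neg {n : ℕ}
    {f : ℝ → EuclideanSpace ℝ (Fin n) → EuclideanSpace ℝ (Fin n) → EuclideanSpace ℝ (Fin n)}
    {I : Set ℝ} {q q' : ℝ → EuclideanSpace ℝ (Fin n)} (hq : IsSolutionSO f I q q') :
    IsSolutionSO (fun t x v => f (-t) x (-v)) (-I) (fun t => q (-t)) (fun t => -q' (-t)) := by
  obtain ⟨⟨a, ha⟩, hI, hsol⟩ := hq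
  refine ⟨⟨-a, by simpa using ha⟩,
    ⟨fun s hs t ht u hu => hI.out ht hs ⟨neg_le_neg hu.2, neg_le_neg hu.1⟩⟩, fun t ht => ?_⟩
  have hneg : HasDerivWithinAt (fun s : ℝ => -s) (-1) (-I) t := (hasDerivWithinAt_id t _).neg
  have h1 := (hsol (-t) ht).1.scomp t hneg fun s hs => hs
  have h2 := ((hsol (-t) ht).2.scomp t hneg fun s hs => hs).neg
  simp only [neg_smul, one_smul, neg_neg] at h1 h2 ⊢
  exact ⟨h1, h2⟩

/-- Time reversal of maximal solutions. -/
theorem IsMaximalSolutionSO.neg {n : ℕ}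
    {f : ℝ → EuclideanSpace ℝ (Fin n) → EuclideanSpace ℝ (Fin n) → EuclideanSpace ℝ (Fin n)}
    {I : Set ℝ} {q q' : ℝ → EuclideanSpace ℝ (Fin n)} (hq : IsMaximalSolutionSO f I q q') :
    IsMaximalSolutionSO (fun t x v => f (-t) x (-v)) (-I) (fun t => q (-t))
      (fun t => -q' (-t)) := by
  refine ⟨hq.1.neg, fun J r r' hr hIJ hqr hqr' => ?_⟩
  have h := hr.neg
  simp only [neg_neg] at h
  refine neg_eq_iff_eq_neg.1 (hq.2 (-J) _ _ h (fun t ht => hIJ (by simpa using ht))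
    (fun t ht => ?_) fun t ht => ?_)
  · simpa using hqr (by simpa using ht : -t ∈ -I)
  · rw [← hqr' (by simpa using ht : -t ∈ -I)]
    simp

/-- **Completeness of second-order ODE flows (Euclidean case).**
With `E(t,q,v) = 1+‖q‖²+‖v‖²`, if for every `r > 0` there are `K(r) > 0`, a gauge
function `g_r` and a continuous family of antisymmetric linear maps `F_t` with
`‖f(t,q,v) - F_t v‖ ≤ g_r(E) E/(K(r)+‖v‖)` on `[-r,r] × ℝⁿ × ℝⁿ`, then every
maximal solution of `q̈ = f(t,q,q̇)` is defined on all of `ℝ`. -/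
theorem second_order_completeness {n : ℕ}
    (f : ℝ → EuclideanSpace ℝ (Fin n) → EuclideanSpace ℝ (Fin n) → EuclideanSpace ℝ (Fin n))
    (hf : Continuous fun p : ℝ × EuclideanSpace ℝ (Fin n) × EuclideanSpace ℝ (Fin n) =>
      f p.1 p.2.1 p.2.2)
    (hbound : ∀ r > (0:ℝ), ∃ K > (0:ℝ), ∃ g : ℝ → ℝ,
      ContinuousOn g (Ici 1) ∧ MonotoneOn g (Ici 1) ∧ (∀ x ∈ Ici (1:ℝ), 1 ≤ g x) ∧
      Tendsto (fun y => ∫ x in (1:ℝ)..y, 1 / (x * g x)) atTop atTop ∧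
      ∃ F : ℝ → EuclideanSpace ℝ (Fin n) →L[ℝ] EuclideanSpace ℝ (Fin n),
        Continuous F ∧
        (∀ (t : ℝ) (v : EuclideanSpace ℝ (Fin n)), ⟪F t v, v⟫ = 0) ∧
        ∀ t ∈ Icc (-r) r, ∀ x v : EuclideanSpace ℝ (Fin n),
          ‖f t x v - F t v‖ ≤
            g (1 + ‖x‖ ^ 2 + ‖v‖ ^ 2) * (1 + ‖x‖ ^ 2 + ‖v‖ ^ 2) / (K + ‖v‖))
    (I : Set ℝ) (q q' : ℝ → EuclideanSpace ℝ (Fin n))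
    (hq : IsMaximalSolutionSO f I q q') : I = Set.univ := by
  have hup := hq.not_bddAbove hf fun r hr => by
    obtain ⟨K, hK, g, hgc, -, hg1, hdiv, F, -, hF, hfF⟩ := hbound r hr
    exact ⟨K, hK, g, hgc, hg1, hdiv, F, hF, hfF⟩
  have hdown := IsMaximalSolutionSO.not_bddAbove (f := fun t x v => f (-t) x (-v))
    (hf.comp (continuous_fst.neg.prodMk (continuous_snd.fst.prodMk continuous_snd.snd.neg)))
    (fun r hr => by
      obtain ⟨K, hK, g, hgc, -, hg1, hdiv, F, -, hF, hfF⟩ := hbound r hr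
      refine ⟨K, hK, g, hgc, hg1, hdiv, fun t => -F (-t), fun t v => by simp [hF],
        fun t ht x v => ?_⟩
      simpa using hfF (-t) ⟨neg_le_neg ht.2, neg_le.1 ht.1⟩ x (-v)) hq.neg
  rw [bddAbove_neg] at hdown
  refine eq_univ_of_forall fun t => ?_
  obtain ⟨u, hu, htu⟩ := not_bddAbove_iff.1 hup t
  obtain ⟨s, hs, hst⟩ := not_bddBelow_iff.1 hdown t
  exact hq.1.2.1.out hs hu ⟨hst.le, htu.le⟩
end

section
/- Let f : ℝ × ℝⁿ × ℝⁿ → ℝⁿ and h : ℝ × ℝⁿ × ℝⁿ → [0,∞) be continuous. Define E(t,q,v) := 1 + ‖q‖² + ‖v‖². Suppose that for every r > 0 there exist a constant K(r) > 0, a continuous non-decreasing function g_r : [1,∞) → [1,∞) with ∫₁^∞ dx/(x g_r(x)) = +∞, and a continuous family of antisymmetric linear maps F_t : ℝⁿ → ℝⁿ, such that ‖f(t,q,v) − F_t v + h(t,q,v) v‖ ≤ g_r(E(t,q,v)) · E(t,q,v) / (K(r) + ‖v‖) for every (t,q,v) ∈ [−r,r] × ℝⁿ × ℝⁿ. Then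 every maximal solution of q̈(t) = f(t, q(t), q̇(t)) is forward complete, i.e. its domain of definition is unbounded above. -/
open Set Filter MeasureTheory
open scoped RealInnerProductSpace

open scoped Topology

section FirstOrder

variable {E : Type*} [NormedAddCommGroup E] [NormedSpace ℝ E]

/-- The Euler scheme with step `h` for `y' = F(t, y)`, `y(a) = x₀`. -/
noncomputable def eulerSeq (F : ℝ → E → E) (a : ℝ) (x₀ : E) (h : ℝ) : ℕ → E
  | 0 => x₀
  | j + 1 => eulerSeq F a x₀ h j + h • F (a + j * h) (eulerSeq F a x₀ h j)

lemma norm_eulerSeq_sub_sub_le {F : ℝ → E → E} {a : ℝ} {x₀ : E} {h : ℝ} (hh : 0 ≤ h)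
    {V : E} {ε : ℝ} {i j : ℕ} (hij : i ≤ j)
    (hF : ∀ l, i ≤ l → l < j → ‖F (a + l * h) (eulerSeq F a x₀ h l) - V‖ ≤ ε) :
    ‖eulerSeq F a x₀ h j - eulerSeq F a x₀ h i - ((j * h - i * h : ℝ)) • V‖
      ≤ ε * (j * h - i * h) := by
  induction j, hij using Nat.le_induction with
  | base => simp
  | succ j hij ih =>
    have h1 := ih fun l hl hl' => hF l hl (hl'.trans (Nat.lt_succ_self j))
    have h2 : ‖h • (F (a + j * h) (eulerSeq F a x₀ h j) - V)‖ ≤ ε * h := by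
      rw [norm_smul, Real.norm_of_nonneg hh, mul_comm]
      exact mul_le_mul_of_nonneg_right (hF j hij (Nat.lt_succ_self j)) hh
    have h3 : eulerSeq F a x₀ h (j + 1) - eulerSeq F a x₀ h i
        - (((j + 1 : ℕ) : ℝ) * h - i * h) • V
        = (eulerSeq F a x₀ h j - eulerSeq F a x₀ h i - ((j * h - i * h : ℝ)) • V)
          + h • (F (a + j * h) (eulerSeq F a x₀ h j) - V) := by
      rw [eulerSeq]
      push_cast
      module
    rw [h3]
    refine (norm_add_le _ _).trans ((add_le_add h1 h2).trans_eq ?_)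
    push_cast
    ring

lemma norm_eulerSeq_sub_le {F : ℝ → E → E} {a : ℝ} {x₀ : E} {h M : ℝ} (hh : 0 ≤ h)
    (hM : ∀ t y, ‖F t y‖ ≤ M) (i j : ℕ) :
    ‖eulerSeq F a x₀ h j - eulerSeq F a x₀ h i‖ ≤ M * |j * h - i * h| := by
  wlog hij : i ≤ j generalizing i j
  · rw [norm_sub_rev, abs_sub_comm]
    exact this j i (le_of_not_ge hij)
  have h0 : (0 : ℝ) ≤ j * h - i * h := by
    have : (i : ℝ) * h ≤ j * h := by gcongr
    linarith
  have := norm_eulerSeq_sub_sub_le (V := 0) hh hij (F := F) (a := a) (x₀ := x₀) (ε := M)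
    fun l _ _ => by simpa using hM _ _
  rw [abs_of_nonneg h0]
  simpa using this

/-- **Peano existence theorem**, for a bounded continuous field. -/
lemma exists_solution_Ici_of_bounded [FiniteDimensional ℝ E] {F : ℝ → E → E}
    (hF : Continuous fun p : ℝ × E => F p.1 p.2) {M : ℝ} (hM : ∀ t y, ‖F t y‖ ≤ M)
    (a : ℝ) (x₀ : E) :
    ∃ x : ℝ → E, x a = x₀ ∧ ∀ t ∈ Ici a, HasDerivWithinAt x (F t (x t)) (Ici a) t := by
  have hM0 : 0 ≤ M := (norm_nonneg _).trans (hM a x₀)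
  have : ProperSpace E := FiniteDimensional.proper ℝ E
  set U : Ultrafilter ℕ := hyperfilter ℕ
  have hU : (U : Filter ℕ) ≤ atTop := Nat.hyperfilter_le_atTop
  set e : ℕ → ℕ → E := fun k => eulerSeq F a x₀ (1 / k : ℝ) with he
  set m : ℕ → ℝ → ℕ := fun k t => ⌊(t - a) * k⌋₊ with hm
  have hk0 : ∀ k : ℕ, (0 : ℝ) ≤ 1 / k := fun k => by positivity
  have hm_tendsto : ∀ t, a ≤ t → Tendsto (fun k => (m k t : ℝ) * (1 / k)) U (𝓝 (t - a)) := by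
    intro t ht
    have := (tendsto_nat_floor_mul_div_atTop (R := ℝ) (sub_nonneg.2 ht)).comp
      (tendsto_natCast_atTop_atTop (R := ℝ))
    refine (this.mono_left hU).congr fun k => ?_
    simp [hm, div_eq_mul_inv]
  have hm_le : ∀ (k : ℕ) t, a ≤ t → (m k t : ℝ) * (1 / k) ≤ t - a := by
    intro k t ht
    have h1 : (m k t : ℝ) ≤ (t - a) * k :=
      Nat.floor_le (mul_nonneg (sub_nonneg.2 ht) (Nat.cast_nonneg k))
    rcases Nat.eq_zero_or_pos k with rfl | hk
    · simpa using ht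
    · have : (0 : ℝ) < k := by exact_mod_cast hk
      rw [mul_one_div, div_le_iff₀ this]
      exact h1
  have hm_ge : ∀ (k : ℕ) t, 0 < k → t - a - 1 / k ≤ (m k t : ℝ) * (1 / k) := by
    intro k t hk
    have hk' : (0 : ℝ) < k := by exact_mod_cast hk
    have h1 : (t - a) * k < m k t + 1 := Nat.lt_floor_add_one _
    have h2 : ((t - a) * k) * (1 / k) ≤ (m k t + 1) * (1 / k) := by gcongr
    have h3 : ((t - a) * k) * (1 / k) = t - a := by field_simp
    linarith
  have hlim : ∀ t, ∃ y, a ≤ t → Tendsto (fun k => e k (m k t)) U (𝓝 y) := by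
    intro t
    by_cases ht : a ≤ t
    · have hmem : ∀ k, e k (m k t) ∈ Metric.closedBall x₀ (M * (t - a)) := by
        intro k
        have h1 := norm_eulerSeq_sub_le (F := F) (a := a) (x₀ := x₀) (hk0 k) hM 0 (m k t)
        rw [mem_closedBall_iff_norm]
        refine h1.trans ?_
        have h2 : (0 : ℝ) ≤ (m k t : ℝ) * (1 / k) := by positivity
        rw [Nat.cast_zero, zero_mul, sub_zero, abs_of_nonneg h2]
        exact mul_le_mul_of_nonneg_left (hm_le k t ht) hM0
      obtain ⟨y, -, hy⟩ := (isCompact_closedBall x₀ (M * (t - a))).ultrafilter_le_nhds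
        (U.map fun k => e k (m k t)) (by
          rw [le_principal_iff]
          exact Filter.mem_map.2 (Filter.univ_mem' hmem))
      exact ⟨y, fun _ => hy⟩
    · exact ⟨x₀, fun h => absurd h ht⟩
  choose x hx using hlim
  refine ⟨x, ?_, ?_⟩
  · refine tendsto_nhds_unique (hx a le_rfl) (tendsto_const_nhds.congr fun k => ?_)
    simp [hm, he, eulerSeq]
  intro t (ht : a ≤ t)
  rw [hasDerivWithinAt_iff_isLittleO, Asymptotics.isLittleO_iff]
  intro ε hε
  obtain ⟨δ, hδ, hδF⟩ := Metric.continuous_iff.1 hF (t, x t) ε hε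
  have hM1 : (0 : ℝ) < M + 1 := by linarith
  set η : ℝ := δ / (4 * (M + 1)) with hη
  have hη0 : 0 < η := by positivity
  have hηM : 4 * ((M + 1) * η) = δ := by rw [hη]; field_simp
  have hMη : 0 ≤ M * η := by positivity
  have hkey : ∀ s₁ s₂, a ≤ s₁ → s₁ ≤ s₂ → |s₁ - t| < η → |s₂ - t| < η →
      ‖x s₂ - x s₁ - (s₂ - s₁) • F t (x t)‖ ≤ ε * (s₂ - s₁) := by
    intro s₁ s₂ hs₁ hs hs₁t hs₂t
    have hs₂ := hs₁.trans hs
    have hc : Tendsto (fun k => (m k s₂ : ℝ) * (1 / k) - m k s₁ * (1 / k)) U (𝓝 (s₂ - s₁)) := by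
      have := (hm_tendsto s₂ hs₂).sub (hm_tendsto s₁ hs₁)
      rwa [sub_sub_sub_cancel_right] at this
    refine le_of_tendsto_of_tendsto
      (((hx s₂ hs₂).sub (hx s₁ hs₁)).sub (hc.smul_const (F t (x t)))).norm
      (hc.const_mul ε) ?_
    have hk1 : ∀ᶠ k : ℕ in U, (1 / k : ℝ) < η :=
      (tendsto_one_div_atTop_nhds_zero_nat.mono_left hU).eventually_lt_const hη0
    have hk2 : ∀ᶠ k : ℕ in U, 0 < k := hU (eventually_gt_atTop 0)
    have hk3 : ∀ᶠ k : ℕ in U, ‖e k (m k t) - x t‖ < δ / 4 := by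
      have := (hx t ht).sub_const (x t)
      rw [sub_self] at this
      exact this.norm.eventually_lt_const (by rw [norm_zero]; positivity)
    filter_upwards [hk1, hk2, hk3] with k hk1 hk2 hk3
    have hmono : m k s₁ ≤ m k s₂ := Nat.floor_le_floor (by gcongr)
    refine norm_eulerSeq_sub_sub_le (hk0 k) hmono fun l hl hl' => ?_
    have hl1 : (m k s₁ : ℝ) * (1 / k) ≤ l * (1 / k) := by gcongr
    have hl2 : (l : ℝ) * (1 / k) ≤ m k s₂ * (1 / k) := by gcongr
    have a1 := hm_ge k s₁ hk2
    have a2 := hm_le k s₂ hs₂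
    have a3 := hm_ge k t hk2
    have a4 := hm_le k t ht
    rw [abs_lt] at hs₁t hs₂t
    have hclose : ‖e k l - e k (m k t)‖ ≤ M * (3 * η) := by
      refine (norm_eulerSeq_sub_le (hk0 k) hM _ _).trans (mul_le_mul_of_nonneg_left ?_ hM0)
      rw [abs_le]
      constructor <;> linarith
    have hdist : dist ((a + l * (1 / k), e k l) : ℝ × E) (t, x t) < δ := by
      rw [Prod.dist_eq, max_lt_iff, Real.dist_eq, dist_eq_norm, abs_lt]
      refine ⟨⟨by dsimp only; linarith, by dsimp only; linarith⟩, ?_⟩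
      have := norm_sub_le_norm_sub_add_norm_sub (e k l) (e k (m k t)) (x t)
      dsimp only
      linarith
    have := hδF _ hdist
    rw [dist_eq_norm] at this
    exact this.le
  have hnear : ∀ᶠ s in 𝓝[Ici a] t, |s - t| < η :=
    mem_nhdsWithin_of_mem_nhds (by
      simpa [Metric.ball, Real.dist_eq] using Metric.ball_mem_nhds t hη0)
  filter_upwards [hnear, self_mem_nhdsWithin] with s hs (hsa : a ≤ s)
  have htt : |t - t| < η := by simpa using hη0
  rcases le_total t s with hts | hst
  · rw [Real.norm_of_nonneg (sub_nonneg.2 hts)]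
    exact hkey t s ht hts htt hs
  · rw [Real.norm_of_nonpos (sub_nonpos.2 hst), neg_sub]
    have hneg : x s - x t - (s - t) • F t (x t) = -(x t - x s - (t - s) • F t (x t)) := by module
    rw [hneg, norm_neg]
    exact hkey s t hsa hst hs htt

/-- **Peano existence theorem**, local form to the right of the initial time. -/
lemma exists_solution_Icc [FiniteDimensional ℝ E] {F : ℝ → E → E}
    (hF : Continuous fun p : ℝ × E => F p.1 p.2) (a : ℝ) (x₀ : E) :
    ∃ c > a, ∃ x : ℝ → E, x a = x₀ ∧
      ∀ t ∈ Icc a c, HasDerivWithinAt x (F t (x t)) (Icc a c) t := by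
  set M : ℝ := ‖F a x₀‖ + 1 with hM
  have hM0 : 0 < M := by positivity
  have hmax : ∀ t y, 0 < max M ‖F t y‖ := fun t y => hM0.trans_le (le_max_left _ _)
  obtain ⟨x, hxa, hx⟩ := exists_solution_Ici_of_bounded
    (F := fun t y => (M / max M ‖F t y‖) • F t y) (M := M)
    ((continuous_const.div (continuous_const.max hF.norm) fun p => (hmax p.1 p.2).ne').smul hF)
    (fun t y => by
      rw [norm_smul, Real.norm_of_nonneg (div_nonneg hM0.le (hmax t y).le), div_mul_eq_mul_div,
        div_le_iff₀ (hmax t y)]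
      exact mul_le_mul_of_nonneg_left (le_max_right _ _) hM0.le) a x₀
  have hcont : ContinuousWithinAt (fun t => ‖F t (x t)‖) (Ici a) a :=
    (hF.continuousAt.comp_continuousWithinAt (f := fun t => (t, x t))
      (continuousWithinAt_id.prodMk (hx a self_mem_Ici).continuousWithinAt)).norm
  have hlt : ∀ᶠ t in 𝓝[≥] a, ‖F t (x t)‖ < M :=
    hcont.eventually_lt_const (by dsimp only; rw [hxa, hM]; linarith)
  obtain ⟨c, hc, hsub⟩ := mem_nhdsGE_iff_exists_Icc_subset.1 hlt
  refine ⟨c, hc, x, hxa, fun t ht => ?_⟩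
  have h1 := (hx t ht.1).mono (Icc_subset_Ici_self : Icc a c ⊆ Ici a)
  have h2 : ‖F t (x t)‖ < M := hsub ht
  simpa only [max_eq_left h2.le, div_self hM0.ne', one_smul] using h1

/-- A solution on an interval `I` and a solution on `[a, c]` with `a ∈ I` which agree on the
overlap glue to a solution on `I ∪ [a, c]`. -/
lemma exists_glued_solution {F : ℝ → E → E} {I : Set ℝ} (hI : I.OrdConnected) {a c : ℝ}
    (ha : a ∈ I) (hac : a ≤ c) {z y : ℝ → E}
    (hz : ∀ t ∈ I, HasDerivWithinAt z (F t (z t)) I t)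
    (hy : ∀ t ∈ Icc a c, HasDerivWithinAt y (F t (y t)) (Icc a c) t)
    (hzy : ∀ t ∈ I, t ∈ Icc a c → z t = y t) :
    ∃ w : ℝ → E, EqOn z w I ∧ (I ∪ Icc a c).OrdConnected ∧
      ∀ t ∈ I ∪ Icc a c, HasDerivWithinAt w (F t (w t)) (I ∪ Icc a c) t := by
  classical
  set w : ℝ → E := fun t => if t ∈ I then z t else y t with hw
  have hwI : ∀ t ∈ I, w t = z t := fun t ht => by simp [hw, ht]
  have hwc : ∀ t ∈ Icc a c, w t = y t := by
    intro t ht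
    by_cases hti : t ∈ I
    · rw [hwI t hti, hzy t hti ht]
    · simp [hw, hti]
  have hdI : ∀ t ∈ I, HasDerivWithinAt w (F t (w t)) I t := fun t ht => by
    rw [hwI t ht]
    exact (hz t ht).congr hwI (hwI t ht)
  have hdc : ∀ t ∈ Icc a c, HasDerivWithinAt w (F t (w t)) (Icc a c) t := fun t ht => by
    rw [hwc t ht]
    exact (hy t ht).congr hwc (hwc t ht)
  refine ⟨w, fun t ht => (hwI t ht).symm, ?_, fun t ht => ?_⟩
  · exact (hI.isPreconnected.union a ha (left_mem_Icc.2 hac) isPreconnected_Icc).ordConnected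
  · by_cases hti : t ∈ I
    · by_cases htc : t ∈ Icc a c
      · exact (hdI t hti).union (hdc t htc)
      · refine (hdI t hti).union (HasFDerivWithinAt.of_notMem_closure ?_)
        rwa [isClosed_Icc.closure_eq]
    · have htc : t ∈ Icc a c := ht.resolve_left hti
      have hat : a < t := htc.1.lt_of_ne fun h => hti (h ▸ ha)
      refine (hdc t htc).mono_of_mem_nhdsWithin ?_
      filter_upwards [self_mem_nhdsWithin, mem_nhdsWithin_of_mem_nhds (Ioi_mem_nhds hat)]
        with s hs (hsa : a < s)
      rcases hs with hs | hs
      · exact ⟨hsa.le, (lt_of_not_ge fun h => hti (hI.out ha hs ⟨hat.le, h⟩)).le.trans htc.2⟩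
      · exact hs

/-- A solution which stays bounded on `[a, b)` extends to a solution on `[a, b]`. -/
lemma exists_solution_Icc_of_bounded_Ico [FiniteDimensional ℝ E] {F : ℝ → E → E}
    (hF : Continuous fun p : ℝ × E => F p.1 p.2) {a b : ℝ} (hab : a < b) {z : ℝ → E}
    (hz : ∀ t ∈ Ico a b, HasDerivWithinAt z (F t (z t)) (Ico a b) t)
    {R : ℝ} (hR : ∀ t ∈ Ico a b, ‖z t‖ ≤ R) :
    ∃ y : ℝ → E, EqOn z y (Ico a b) ∧
      ∀ t ∈ Icc a b, HasDerivWithinAt y (F t (y t)) (Icc a b) t := by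
  have : ProperSpace E := FiniteDimensional.proper ℝ E
  obtain ⟨C, hC⟩ := ((isCompact_Icc (a := a) (b := b)).prod
    (isCompact_closedBall (0 : E) R)).exists_bound_of_continuousOn hF.continuousOn
  have hlip : LipschitzOnWith C.toNNReal z (Ico a b) := by
    refine (convex_Ico a b).lipschitzOnWith_of_nnnorm_hasDerivWithin_le hz fun t ht => ?_
    rw [← NNReal.coe_le_coe, coe_nnnorm]
    refine (hC (t, z t) ⟨Ico_subset_Icc_self ht, ?_⟩).trans (Real.le_coe_toNNReal C)
    simpa using hR t ht
  obtain ⟨y, hy, hzy⟩ := hlip.extend_finite_dimension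
  have hyd : ∀ t ∈ Ico a b, HasDerivWithinAt y (F t (y t)) (Ico a b) t := fun t ht => by
    rw [← hzy ht]
    exact (hz t ht).congr (fun s hs => (hzy hs).symm) (hzy ht).symm
  have hyI : ∀ t ∈ Ioo a b, HasDerivAt y (F t (y t)) t := fun t ht =>
    (hyd t (Ioo_subset_Ico_self ht)).hasDerivAt (Ico_mem_nhds ht.1 ht.2)
  refine ⟨y, hzy, fun t ht => ?_⟩
  rcases ht.2.lt_or_eq with htb | rfl
  · refine (hyd t ⟨ht.1, htb⟩).mono_of_mem_nhdsWithin ?_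
    filter_upwards [self_mem_nhdsWithin, mem_nhdsWithin_of_mem_nhds (Iio_mem_nhds htb)]
      with s hs hs'
    exact ⟨hs.1, hs'⟩
  · have hmem : Ioo a t ∈ 𝓝[<] t := Ioo_mem_nhdsLT hab
    refine (hasDerivWithinAt_Iic_of_tendsto_deriv (s := Ioo a t)
      (fun s hs => (hyI s hs).differentiableAt.differentiableWithinAt)
      hy.continuous.continuousWithinAt hmem ?_).mono Icc_subset_Iic_self
    have hc : Continuous fun s => F s (y s) := hF.comp (continuous_id.prodMk hy.continuous)
    refine (hc.tendsto t |>.mono_left nhdsWithin_le_nhds).congr' ?_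
    filter_upwards [hmem] with s hs
    exact (hyI s hs).deriv.symm

/-- **Extension of bounded solutions.** A solution on an interval `I` with finite supremum `b`
which stays bounded on `I ∩ [a, b)` whenever `b ∉ I` extends to a strictly larger interval. -/
lemma exists_ssubset_solution [FiniteDimensional ℝ E] {F : ℝ → E → E}
    (hF : Continuous fun p : ℝ × E => F p.1 p.2) {I : Set ℝ} (hI : I.OrdConnected) {a b : ℝ}
    (ha : a ∈ I) (hb : IsLUB I b) {z : ℝ → E}
    (hz : ∀ t ∈ I, HasDerivWithinAt z (F t (z t)) I t)
    (hbdd : b ∉ I → ∃ R, ∀ t ∈ I, a ≤ t → ‖z t‖ ≤ R) :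
    ∃ (J : Set ℝ) (w : ℝ → E), I ⊂ J ∧ J.OrdConnected ∧ EqOn z w I ∧
      ∀ t ∈ J, HasDerivWithinAt w (F t (w t)) J t := by
  by_cases hbI : b ∈ I
  · obtain ⟨c, hbc, y, hyb, hy⟩ := exists_solution_Icc hF b (z b)
    obtain ⟨w, hw, hJ, hwd⟩ := exists_glued_solution hI hbI hbc.le hz hy fun t ht htc => by
      rw [le_antisymm (hb.1 ht) htc.1, hyb]
    refine ⟨_, w, ⟨subset_union_left, fun h => ?_⟩, hJ, hw, hwd⟩
    exact (hb.1 (h (Or.inr (right_mem_Icc.2 hbc.le)))).not_gt hbc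
  · obtain ⟨R, hR⟩ := hbdd hbI
    have hab : a < b := (hb.1 ha).lt_of_ne fun h => hbI (h ▸ ha)
    have hsub : Ico a b ⊆ I := fun t ht => by
      obtain ⟨s, hs, hts⟩ := (lt_isLUB_iff hb).1 ht.2
      exact hI.out ha hs ⟨ht.1, hts.le⟩
    obtain ⟨y, hzy, hy⟩ := exists_solution_Icc_of_bounded_Ico hF hab
      (fun t ht => (hz t (hsub ht)).mono hsub) (fun t ht => hR t (hsub ht) ht.1)
    obtain ⟨w, hw, hJ, hwd⟩ := exists_glued_solution hI ha hab.le hz hy fun t ht htc =>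
      hzy ⟨htc.1, htc.2.lt_of_ne fun h => hbI (h ▸ ht)⟩
    exact ⟨_, w, ⟨subset_union_left, fun h => hbI (h (Or.inr (right_mem_Icc.2 hab.le)))⟩,
      hJ, hw, hwd⟩

end FirstOrder

/-- **Osgood-type bound.** If `u ≥ 1` satisfies `u' ≤ C u g(u)` on `[a, b)` and
`∫₁^∞ dx / (x g(x)) = ∞`, then `u` is bounded on `[a, b)`. -/
lemma exists_bound_of_deriv_le_mul_gauge {g : ℝ → ℝ} (hg : ContinuousOn g (Ici 1))
    (hg1 : ∀ x ∈ Ici (1 : ℝ), 1 ≤ g x)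
    (hint : Tendsto (fun y => ∫ x in (1:ℝ)..y, 1 / (x * g x)) atTop atTop)
    {a b C : ℝ} (hC : 0 ≤ C) {u u' : ℝ → ℝ} (hu1 : ∀ t ∈ Ico a b, 1 ≤ u t)
    (hu : ∀ t ∈ Ico a b, HasDerivWithinAt u (u' t) (Ico a b) t)
    (hu' : ∀ t ∈ Ico a b, u' t ≤ C * (u t * g (u t))) :
    ∃ Y, ∀ t ∈ Ico a b, u t ≤ Y := by
  set φ : ℝ → ℝ := fun x => 1 / (max 1 x * g (max 1 x)) with hφ
  have hpos : ∀ x : ℝ, 0 < max 1 x * g (max 1 x) := fun x =>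
    mul_pos (zero_lt_one.trans_le (le_max_left _ _))
      (zero_lt_one.trans_le (hg1 _ (le_max_left (1 : ℝ) x)))
  have hφc : Continuous φ := by
    have hm : Continuous fun x : ℝ => max 1 x := continuous_const.max continuous_id
    have hgm : Continuous fun x : ℝ => g (max 1 x) :=
      hg.comp_continuous hm fun x => mem_Ici.2 (le_max_left _ _)
    exact continuous_const.div (hm.mul hgm) fun x => (hpos x).ne'
  set G : ℝ → ℝ := fun y => ∫ x in (1:ℝ)..y, φ x with hG
  have hGd : ∀ y, HasDerivAt G (φ y) y := fun y =>
    intervalIntegral.integral_hasDerivAt_right (hφc.intervalIntegrable _ _)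
      hφc.aestronglyMeasurable.stronglyMeasurableAtFilter hφc.continuousAt
  have hGtop : Tendsto G atTop atTop := by
    refine hint.congr' ?_
    filter_upwards [eventually_ge_atTop (1 : ℝ)] with y hy
    refine intervalIntegral.integral_congr fun x hx => ?_
    rw [uIcc_of_le hy] at hx
    simp [hφ, max_eq_right hx.1]
  have hGu : ∀ t ∈ Ico a b, G (u t) ≤ G (u a) + C * (b - a) := by
    intro t ht
    have hsub : Icc a t ⊆ Ico a b := fun s hs => ⟨hs.1, hs.2.trans_lt ht.2⟩
    have hd : ∀ s ∈ Ioo a t, HasDerivAt (fun s => G (u s)) (φ (u s) * u' s) s := fun s hs =>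
      (hGd (u s)).comp s ((hu s (hsub (Ioo_subset_Icc_self hs))).hasDerivAt
        (Ico_mem_nhds hs.1 (hs.2.trans ht.2)))
    have hcont : ContinuousOn (fun s => G (u s)) (Icc a t) := fun s hs =>
      (hGd (u s)).continuousAt.comp_continuousWithinAt
        ((hu s (hsub hs)).continuousWithinAt.mono hsub)
    have := (convex_Icc a t).image_sub_le_mul_sub_of_deriv_le (C := C) hcont
      (fun s hs => (hd s (by rwa [interior_Icc] at hs)).differentiableAt.differentiableWithinAt)
      (fun s hs => by
        rw [interior_Icc] at hs
        have hs' := hsub (Ioo_subset_Icc_self hs)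
        have h1 := hpos (u s)
        have h2 := hu' s hs'
        rw [(hd s hs).deriv]
        simp only [hφ]
        rw [one_div_mul_eq_div, div_le_iff₀ h1, max_eq_right (hu1 s hs')]
        exact h2) a (left_mem_Icc.2 ht.1) t (right_mem_Icc.2 ht.1) ht.1
    have h3 : C * (t - a) ≤ C * (b - a) :=
      mul_le_mul_of_nonneg_left (sub_le_sub_right ht.2.le a) hC
    linarith
  obtain ⟨Y, hY⟩ := eventually_atTop.1 (hGtop.eventually_gt_atTop (G (u a) + C * (b - a)))
  exact ⟨Y, fun t ht => le_of_not_gt fun h => (hGu t ht).not_gt (hY _ h.le)⟩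

/-- The friction term and the antisymmetric term do not contribute to the growth of the energy. -/
lemma two_mul_inner_add_two_mul_inner_le {V : Type*} [NormedAddCommGroup V]
    [InnerProductSpace ℝ V] {x v f Fv : V} {η K c : ℝ} (hη : 0 ≤ η) (hK : 0 < K) (hc : 1 ≤ c)
    (hF : ⟪Fv, v⟫ = 0)
    (hf : ‖f - Fv + η • v‖ ≤ c * (1 + ‖x‖ ^ 2 + ‖v‖ ^ 2) / (K + ‖v‖)) :
    2 * ⟪x, v⟫ + 2 * ⟪v, f⟫ ≤ 3 * ((1 + ‖x‖ ^ 2 + ‖v‖ ^ 2) * c) := by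
  set e := 1 + ‖x‖ ^ 2 + ‖v‖ ^ 2 with he
  have he0 : 0 < e := by positivity
  have h1 : 2 * ⟪x, v⟫ ≤ e := by
    have := real_inner_le_norm x v
    nlinarith [sq_nonneg (‖x‖ - ‖v‖)]
  have h2 : ⟪v, f⟫ = ⟪v, f - Fv + η • v⟫ - η * ‖v‖ ^ 2 := by
    rw [inner_add_right, inner_sub_right, inner_smul_right, real_inner_self_eq_norm_sq,
      real_inner_comm Fv v, hF]
    ring
  have h3 : ⟪v, f - Fv + η • v⟫ ≤ c * e := by
    have hKv : 0 < K + ‖v‖ := by positivity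
    have h4 : ‖f - Fv + η • v‖ * (K + ‖v‖) ≤ c * e := (le_div_iff₀ hKv).1 hf
    have h5 := real_inner_le_norm v (f - Fv + η • v)
    nlinarith [mul_nonneg hK.le (norm_nonneg (f - Fv + η • v))]
  have h6 : 0 ≤ η * ‖v‖ ^ 2 := by positivity
  have h7 : e ≤ e * c := le_mul_of_one_le_right he0.le hc
  linarith

/-- **Forward completeness in the presence of friction.**
With `E(t,q,v) = 1+‖q‖²+‖v‖²`, suppose `f` and `h ≥ 0` are continuous and for
every `r > 0` there are `K(r) > 0`, a gauge function `g_r` and a continuous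
family of antisymmetric linear maps `F_t` such that
`‖f(t,q,v) - F_t v + h(t,q,v) v‖ ≤ g_r(E) E/(K(r)+‖v‖)` on `[-r,r] × ℝⁿ × ℝⁿ`.
Then every maximal solution of `q̈ = f(t,q,q̇)` is forward complete, i.e. its
domain is unbounded above. -/
theorem second_order_forward_completeness_friction {n : ℕ}
    (f : ℝ → EuclideanSpace ℝ (Fin n) → EuclideanSpace ℝ (Fin n) → EuclideanSpace ℝ (Fin n))
    (h : ℝ → EuclideanSpace ℝ (Fin n) → EuclideanSpace ℝ (Fin n) → ℝ)
    (hf : Continuous fun p : ℝ × EuclideanSpace ℝ (Fin n) × EuclideanSpace ℝ (Fin n) =>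
      f p.1 p.2.1 p.2.2)
    (hh : Continuous fun p : ℝ × EuclideanSpace ℝ (Fin n) × EuclideanSpace ℝ (Fin n) =>
      h p.1 p.2.1 p.2.2)
    (hhnn : ∀ (t : ℝ) (x v : EuclideanSpace ℝ (Fin n)), 0 ≤ h t x v)
    (hbound : ∀ r > (0:ℝ), ∃ K > (0:ℝ), ∃ g : ℝ → ℝ,
      ContinuousOn g (Ici 1) ∧ MonotoneOn g (Ici 1) ∧ (∀ x ∈ Ici (1:ℝ), 1 ≤ g x) ∧
      Tendsto (fun y => ∫ x in (1:ℝ)..y, 1 / (x * g x)) atTop atTop ∧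
      ∃ F : ℝ → EuclideanSpace ℝ (Fin n) →L[ℝ] EuclideanSpace ℝ (Fin n),
        Continuous F ∧
        (∀ (t : ℝ) (v : EuclideanSpace ℝ (Fin n)), ⟪F t v, v⟫ = 0) ∧
        ∀ t ∈ Icc (-r) r, ∀ x v : EuclideanSpace ℝ (Fin n),
          ‖f t x v - F t v + h t x v • v‖ ≤
            g (1 + ‖x‖ ^ 2 + ‖v‖ ^ 2) * (1 + ‖x‖ ^ 2 + ‖v‖ ^ 2) / (K + ‖v‖))
    (I : Set ℝ) (q q' : ℝ → EuclideanSpace ℝ (Fin n))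
    (hq : IsMaximalSolutionSO f I q q') : ¬ BddAbove I := by
  intro hbd
  obtain ⟨⟨⟨a, ha⟩, hI, hsol⟩, hmax⟩ := hq
  obtain ⟨b, hb⟩ : ∃ b, IsLUB I b := ⟨_, isLUB_csSup ⟨a, ha⟩ hbd⟩
  have hΦ : Continuous fun p : ℝ × (EuclideanSpace ℝ (Fin n) × EuclideanSpace ℝ (Fin n)) =>
      (p.2.2, f p.1 p.2.1 p.2.2) := (continuous_snd.comp continuous_snd).prodMk hf
  obtain ⟨J, w, hIJ, hJ, hw, hwd⟩ := exists_ssubset_solution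
    (F := fun t p => (p.2, f t p.1 p.2)) hΦ hI ha hb (z := fun t => (q t, q' t))
    (fun t ht => (hsol t ht).1.prodMk (hsol t ht).2) (by
      intro hbI
      have hsub : Ico a b ⊆ I := fun t ht => by
        obtain ⟨s, hs, hts⟩ := (lt_isLUB_iff hb).1 ht.2
        exact hI.out ha hs ⟨ht.1, hts.le⟩
      obtain ⟨K, hK, g, hg, -, hg1, hint, F, -, hF, hle⟩ := hbound (|a| + |b| + 1) (by positivity)
      have he1 : ∀ x v : EuclideanSpace ℝ (Fin n), 1 ≤ 1 + ‖x‖ ^ 2 + ‖v‖ ^ 2 := fun x v => by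
        nlinarith [sq_nonneg ‖x‖, sq_nonneg ‖v‖]
      obtain ⟨Y, hY⟩ := exists_bound_of_deriv_le_mul_gauge hg hg1 hint (a := a) (b := b)
        (C := 3) (by norm_num) (u := fun t => 1 + ‖q t‖ ^ 2 + ‖q' t‖ ^ 2)
        (u' := fun t => 2 * ⟪q t, q' t⟫ + 2 * ⟪q' t, f t (q t) (q' t)⟫)
        (fun t _ => he1 _ _)
        (fun t ht => ((((hsol t (hsub ht)).1.norm_sq).const_add 1).add
          (hsol t (hsub ht)).2.norm_sq).mono hsub)
        (fun t ht => two_mul_inner_add_two_mul_inner_le (hhnn t _ _) hK (hg1 _ (he1 _ _))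
          (hF t _) (hle t ⟨by linarith [ht.1, neg_abs_le a, abs_nonneg b],
            by linarith [ht.2, le_abs_self b, abs_nonneg a]⟩ _ _))
      refine ⟨Y, fun t ht hat => ?_⟩
      have hYt : 1 + ‖q t‖ ^ 2 + ‖q' t‖ ^ 2 ≤ Y :=
        hY t ⟨hat, (hb.1 ht).lt_of_ne fun h => hbI (h ▸ ht)⟩
      rw [Prod.norm_def, max_le_iff]
      constructor <;> dsimp only <;>
        nlinarith [sq_nonneg (‖q t‖ - 1), sq_nonneg (‖q' t‖ - 1), sq_nonneg ‖q t‖,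
          sq_nonneg ‖q' t‖])
  refine hIJ.ne (hmax J (fun t => (w t).1) (fun t => (w t).2)
    ⟨⟨a, hIJ.1 ha⟩, hJ, fun t ht => ⟨?_, ?_⟩⟩ hIJ.1
    (fun t ht => congrArg Prod.fst (hw ht)) (fun t ht => congrArg Prod.snd (hw ht))).symm
  · exact hasFDerivAt_fst.comp_hasDerivWithinAt t (hwd t ht)
  · exact hasFDerivAt_snd.comp_hasDerivWithinAt t (hwd t ht)
end
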